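/- For all n ≥ 1 and all σ, τ ∈ S_n with Des(σ) = Des(τ), one has c_σ = c_τ in ℤ[a,b]. -/

import Mathlib

open MvPolynomial

/-- Narayana number T(n,k) = (1/k)·C(n−1,k−1)·C(n,k−1). -/
def narayana (n k : ℕ) : ℕ := ((n - 1).choose (k - 1) * n.choose (k - 1)) / k

/-- ca_n(a,b), with a = X 0, b = X 1. -/
noncomputable def caP (n : ℕ) : MvPolynomial (Fin 2) ℤ :=
  ∑ i ∈ Finset.range n, (narayana n (i + 1) : MvPolynomial (Fin 2) ℤ) * X 0 ^ i * X 1 ^ (n - 1 - i)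

/-- The standardization of a word with distinct letters: each letter is replaced by its rank. -/
def stdW (w : List ℕ) : List ℕ := w.map fun x => (w.filter (· ≤ x)).length

/-- a_k = a for k ≥ 2, a_1 = 1. -/
noncomputable def aW (k : ℕ) : MvPolynomial (Fin 2) ℤ := if 2 ≤ k then X 0 else 1

/-- b_k = b for k ≥ 2, b_1 = 1. -/
noncomputable def bW (k : ℕ) : MvPolynomial (Fin 2) ℤ := if 2 ≤ k then X 1 else 1

/-- Fuel-based auxiliary for the recursive definition of c_σ on words. -/
noncomputable def cAux : ℕ → List ℕ → MvPolynomial (Fin 2) ℤ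
  | 0, _ => 1
  | f + 1, w =>
    if w.length ≤ 1 then 1
    else
      (∑ k ∈ Finset.Ioo 0 w.length,
        if 1 ∈ w.take k ∧ w.length ∈ w.drop k then
          bW k * aW (w.length - k) * cAux f (stdW (w.take k)) * cAux f (stdW (w.drop k))
        else 0)
      -
      (∑ k ∈ Finset.Ioo 0 w.length,
        if w.length ∈ w.take k ∧ 1 ∈ w.drop k then
          aW k * bW (w.length - k) * cAux f (stdW (w.take k)) * cAux f (stdW (w.drop k))
        else 0)

/-- The polynomial c_σ ∈ ℤ[a,b] of a permutation word σ (a word on {1,…,n}). -/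
noncomputable def cpol (w : List ℕ) : MvPolynomial (Fin 2) ℤ := cAux w.length w

/-- The word σ(1)σ(2)⋯σ(n) ∈ {1,…,n}ⁿ of a permutation σ ∈ S_n. -/
def permWord {n : ℕ} (σ : Equiv.Perm (Fin n)) : List ℕ := List.ofFn fun i => (σ i : ℕ) + 1

/-- The descent set Des(w) = {i ∈ {1,…,|w|−1} : w(i) > w(i+1)} of a word (positions 1-based). -/
def desSet (w : List ℕ) : Finset ℕ :=
  (Finset.Icc 1 (w.length - 1)).filter fun i => w.getD i 0 < w.getD (i - 1) 0

/-! ### Recursions driven by a descent pattern -/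

/-- `p` is a local minimum of the interval `[i, j)` for the descent pattern `D`, where `D k` says
that there is a descent from `k` to `k + 1`. -/
def IsValley (D : ℕ → Prop) (i j p : ℕ) : Prop :=
  i ≤ p ∧ p < j ∧ (∀ k, i ≤ k → k + 1 = p → D k) ∧ (p + 1 < j → ¬ D p)

/-- `m` is a local maximum of the interval `[i, j)` for the descent pattern `D`. -/
def IsPeak (D : ℕ → Prop) (i j m : ℕ) : Prop :=
  IsValley (fun k => ¬ D k) i j m

lemma IsValley.isPeak_not {D : ℕ → Prop} {i j p : ℕ} (h : IsValley D i j p) :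
    IsPeak (fun k => ¬ D k) i j p := by
  simpa [IsPeak, not_not] using h

lemma IsValley.mono {D : ℕ → Prop} {i j i' j' p : ℕ} (h : IsValley D i j p)
    (hi : i ≤ i') (hj : j' ≤ j) (hip : i' ≤ p) (hpj : p < j') : IsValley D i' j' p :=
  ⟨hip, hpj, fun k hk hkp => h.2.2.1 k (hi.trans hk) hkp, fun hp => h.2.2.2 (hp.trans_le hj)⟩

lemma IsValley.ne_isPeak {D : ℕ → Prop} {i j p m : ℕ} (hij : i + 2 ≤ j)
    (hp : IsValley D i j p) (hm : IsPeak D i j m) : p ≠ m := by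
  rintro rfl
  obtain ⟨h1, h2, h3, h4⟩ := hp
  obtain ⟨-, -, h5, h6⟩ := hm
  by_cases h : p + 1 < j
  · exact h6 h (h4 h)
  · exact h5 (p - 1) (by omega) (by omega) (h3 (p - 1) (by omega) (by omega))

lemma IsValley.exists_isPeak_between {D : ℕ → Prop} {i j p q : ℕ}
    (hp : IsValley D i j p) (hq : IsValley D i j q) (hpq : p < q) :
    ∃ m, p < m ∧ m < q ∧ IsPeak D i j m := by
  classical
  obtain ⟨p1, p2, p3, p4⟩ := hp
  obtain ⟨q1, q2, q3, q4⟩ := hq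
  have hD : D (q - 1) := q3 (q - 1) (by omega) (by omega)
  have hDp : ¬ D p := p4 (by omega)
  have hex : ∃ k, p < k ∧ D k := by
    refine ⟨q - 1, ?_, hD⟩
    rcases Nat.lt_or_ge p (q - 1) with h | h
    · exact h
    · exact absurd (by rwa [show q - 1 = p by omega] at hD) hDp
  obtain ⟨hm1, hm2⟩ := Nat.find_spec hex
  have hle : Nat.find hex ≤ q - 1 := by
    refine Nat.find_min' hex ⟨?_, hD⟩
    by_contra h
    exact hDp (by rwa [show q - 1 = p by omega] at hD)
  refine ⟨Nat.find hex, hm1, by omega, by omega, by omega, ?_, ?_⟩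
  · intro k hk hkm hDk
    rcases Nat.lt_or_ge p k with h | h
    · exact Nat.find_min hex (show k < Nat.find hex by omega) ⟨h, hDk⟩
    · exact hDp (by rwa [show k = p by omega] at hDk)
  · intro _ h
    exact h hm2

section Abstract

variable {R : Type*} [CommRing R]

/-- The signed sum over all cuts of `[i, j)` separating `p` (playing the role of the minimum)
from `m` (playing the role of the maximum). -/
def cutSum (a b : ℕ → R) (F : ℕ → ℕ → R) (i j p m : ℕ) : R :=
  if p < m then ∑ x ∈ Finset.Ioc p m, b (x - i) * a (j - x) * F i x * F x j
  else - ∑ x ∈ Finset.Ioc m p, a (x - i) * b (j - x) * F i x * F x j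

/-- `F i j` is computed by `cutSum` for every choice of a valley and a peak. -/
def CutIndep (a b : ℕ → R) (D : ℕ → Prop) (F : ℕ → ℕ → R) (i j : ℕ) : Prop :=
  ∀ p m, IsValley D i j p → IsPeak D i j m → F i j = cutSum a b F i j p m

lemma cutSum_neg {a b : ℕ → R} {F : ℕ → ℕ → R} {i j p m : ℕ} (h : p ≠ m) :
    cutSum b a (fun x y => - F x y) i j m p = - cutSum a b F i j p m := by
  rcases Nat.lt_or_gt_of_ne h with h | h
  · simp [cutSum, h, h.not_gt]
  · simp [cutSum, h, h.not_gt]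

lemma CutIndep.neg {a b : ℕ → R} {D : ℕ → Prop} {F : ℕ → ℕ → R} {i j : ℕ} (hij : i + 2 ≤ j)
    (h : CutIndep a b D F i j) :
    CutIndep b a (fun k => ¬ D k) (fun x y => - F x y) i j := by
  intro p m hp hm
  have hm' : IsValley D i j m := by simpa [IsPeak, not_not] using hm
  rw [cutSum_neg (hm'.ne_isPeak hij hp), ← h m p hm' hp]

lemma sum_cut_add_sum_cut_eq_zero {a b α β : ℕ → R} {D : ℕ → Prop} {F : ℕ → ℕ → R}
    {i j p m q : ℕ}
    (IH : ∀ i' j', i ≤ i' → j' ≤ j → j' - i' < j - i → i' + 2 ≤ j' → CutIndep a b D F i' j')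
    (hp : IsValley D i j p) (hm : IsPeak D i j m) (hq : IsValley D i j q)
    (hpm : p < m) (hmq : m < q)
    (hαβ : ∀ x y, p < x → x ≤ m → m < y → y ≤ q → α x * b (j - y) = β y * b (x - i)) :
    ∑ x ∈ Finset.Ioc p m, α x * F i x * F x j + ∑ y ∈ Finset.Ioc m q, β y * F i y * F y j = 0 := by
  have hi := hp.1
  have hj := hq.2.1
  have h1 : ∑ x ∈ Finset.Ioc p m, α x * F i x * F x j =
      - ∑ x ∈ Finset.Ioc p m, ∑ y ∈ Finset.Ioc m q,
        α x * b (j - y) * (a (y - x) * F i x * F x y * F y j) := by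
    rw [← Finset.sum_neg_distrib]
    refine Finset.sum_congr rfl fun x hx => ?_
    rw [Finset.mem_Ioc] at hx
    rw [IH x j (by omega) le_rfl (by omega) (by omega) q m
      (hq.mono (by omega) le_rfl (by omega) hj)
      (IsValley.mono hm (by omega) le_rfl hx.2 (by omega)), cutSum, if_neg hmq.not_gt,
      mul_neg, Finset.mul_sum]
    congr 1
    exact Finset.sum_congr rfl fun y _ => by ring
  have h2 : ∑ y ∈ Finset.Ioc m q, β y * F i y * F y j =
      ∑ x ∈ Finset.Ioc p m, ∑ y ∈ Finset.Ioc m q,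
        β y * b (x - i) * (a (y - x) * F i x * F x y * F y j) := by
    rw [Finset.sum_comm]
    refine Finset.sum_congr rfl fun y hy => ?_
    rw [Finset.mem_Ioc] at hy
    rw [IH i y le_rfl (by omega) (by omega) (by omega) p m
      (hp.mono le_rfl (by omega) hi (by omega))
      (IsValley.mono hm le_rfl (by omega) (by omega) hy.1), cutSum, if_pos hpm,
      Finset.mul_sum, Finset.sum_mul]
    exact Finset.sum_congr rfl fun x _ => by ring
  rw [h1, h2, neg_add_eq_zero]
  refine Finset.sum_congr rfl fun x hx => Finset.sum_congr rfl fun y hy => ?_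
  rw [Finset.mem_Ioc] at hx hy
  rw [hαβ x y hx.1 hx.2 hy.1 hy.2]

lemma cutSum_eq_of_isValley_of_lt {a b : ℕ → R} {D : ℕ → Prop} {F : ℕ → ℕ → R} {i j p q m : ℕ}
    (ha : ∀ k, 2 ≤ k → a k = a 2) (hb : ∀ k, 2 ≤ k → b k = b 2)
    (IH : ∀ i' j', i ≤ i' → j' ≤ j → j' - i' < j - i → i' + 2 ≤ j' → CutIndep a b D F i' j')
    (hp : IsValley D i j p) (hq : IsValley D i j q) (hm : IsPeak D i j m) (hpq : p < q) :
    cutSum a b F i j p m = cutSum a b F i j q m := by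
  have hi := hp.1
  have hqj := hq.2.1
  have hmj := hm.2.1
  have him := hm.1
  have hpm := hp.ne_isPeak (by omega) hm
  have hqm := hq.ne_isPeak (by omega) hm
  rcases Nat.lt_or_gt_of_ne hpm with hpm | hpm
  · rcases Nat.lt_or_gt_of_ne hqm with hqm | hqm
    · obtain ⟨r, hpr, hrq, hr⟩ := hp.exists_isPeak_between hq hpq
      have h := sum_cut_add_sum_cut_eq_zero (α := fun x => b (x - i) * a (j - x))
        (β := fun x => b (x - i) * a (j - x)) IH hp hr hq hpr hrq (by
          intro x y h1 h2 h3 h4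
          rw [ha (j - x) (by omega), hb (j - y) (by omega), hb (y - i) (by omega),
            ha (j - y) (by omega)]
          ring)
      rw [Finset.sum_Ioc_consecutive _ hpr.le hrq.le] at h
      rw [cutSum, cutSum, if_pos hpm, if_pos hqm,
        ← Finset.sum_Ioc_consecutive _ hpq.le hqm.le, h, zero_add]
    · have h := sum_cut_add_sum_cut_eq_zero (α := fun x => b (x - i) * a (j - x))
        (β := fun x => a (x - i) * b (j - x)) IH hp hm hq hpm hqm (by
          intro x y h1 h2 h3 h4
          rw [ha (j - x) (by omega), ha (y - i) (by omega)]
          ring)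
      rw [cutSum, cutSum, if_pos hpm, if_neg hqm.not_gt]
      exact eq_neg_of_add_eq_zero_left h
  · obtain ⟨r, hpr, hrq, hr⟩ := hp.exists_isPeak_between hq hpq
    have h := sum_cut_add_sum_cut_eq_zero (α := fun x => a (x - i) * b (j - x))
      (β := fun x => a (x - i) * b (j - x)) IH hp hr hq hpr hrq (by
        intro x y h1 h2 h3 h4
        rw [ha (x - i) (by omega), hb (j - x) (by omega), ha (y - i) (by omega),
          hb (x - i) (by omega)]
        ring)
    rw [Finset.sum_Ioc_consecutive _ hpr.le hrq.le] at h
    rw [cutSum, cutSum, if_neg hpm.not_gt, if_neg (hpm.trans hpq).not_gt,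
      ← Finset.sum_Ioc_consecutive _ hpm.le hpq.le, h, add_zero]

lemma cutSum_eq_of_isValley {a b : ℕ → R} {D : ℕ → Prop} {F : ℕ → ℕ → R} {i j p q m : ℕ}
    (ha : ∀ k, 2 ≤ k → a k = a 2) (hb : ∀ k, 2 ≤ k → b k = b 2)
    (IH : ∀ i' j', i ≤ i' → j' ≤ j → j' - i' < j - i → i' + 2 ≤ j' → CutIndep a b D F i' j')
    (hp : IsValley D i j p) (hq : IsValley D i j q) (hm : IsPeak D i j m) :
    cutSum a b F i j p m = cutSum a b F i j q m := by
  rcases lt_trichotomy p q with h | rfl | h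
  · exact cutSum_eq_of_isValley_of_lt ha hb IH hp hq hm h
  · rfl
  · exact (cutSum_eq_of_isValley_of_lt ha hb IH hq hp hm h).symm

lemma cutSum_eq_of_isPeak {a b : ℕ → R} {D : ℕ → Prop} {F : ℕ → ℕ → R} {i j p m m' : ℕ}
    (ha : ∀ k, 2 ≤ k → a k = a 2) (hb : ∀ k, 2 ≤ k → b k = b 2) (hij : i + 2 ≤ j)
    (IH : ∀ i' j', i ≤ i' → j' ≤ j → j' - i' < j - i → i' + 2 ≤ j' → CutIndep a b D F i' j')
    (hp : IsValley D i j p) (hm : IsPeak D i j m) (hm' : IsPeak D i j m') :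
    cutSum a b F i j p m = cutSum a b F i j p m' := by
  have h := cutSum_eq_of_isValley (F := fun x y => - F x y) hb ha
    (fun i' j' h1 h2 h3 h4 => (IH i' j' h1 h2 h3 h4).neg h4) hm hm' hp.isPeak_not
  rwa [cutSum_neg (hp.ne_isPeak hij hm), cutSum_neg (hp.ne_isPeak hij hm'), neg_inj] at h

/-- If on every interval the recursion holds for one choice of valley and peak, then it holds for
all choices. -/
lemma cutIndep_of_exists {a b : ℕ → R} {D : ℕ → Prop} {F : ℕ → ℕ → R} {n : ℕ}
    (ha : ∀ k, 2 ≤ k → a k = a 2) (hb : ∀ k, 2 ≤ k → b k = b 2)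
    (hF : ∀ i j, i + 2 ≤ j → j ≤ n →
      ∃ p m, IsValley D i j p ∧ IsPeak D i j m ∧ F i j = cutSum a b F i j p m)
    (i j : ℕ) (hij : i + 2 ≤ j) (hj : j ≤ n) : CutIndep a b D F i j := by
  induction hd : j - i using Nat.strong_induction_on generalizing i j with
  | _ d IH =>
    have IH' : ∀ i' j', i ≤ i' → j' ≤ j → j' - i' < j - i → i' + 2 ≤ j' →
        CutIndep a b D F i' j' := fun i' j' _ h2 h3 h4 =>
      IH (j' - i') (by omega) i' j' h4 (by omega) rfl
    intro p m hp hm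
    obtain ⟨p₀, m₀, hp₀, hm₀, h⟩ := hF i j hij hj
    rw [h, cutSum_eq_of_isValley ha hb IH' hp₀ hp hm₀, cutSum_eq_of_isPeak ha hb hij IH' hp hm₀ hm]

lemma eq_of_exists_cutSum {a b : ℕ → R} {D : ℕ → Prop} {F F' : ℕ → ℕ → R} {n : ℕ}
    (ha : ∀ k, 2 ≤ k → a k = a 2) (hb : ∀ k, 2 ≤ k → b k = b 2)
    (h1 : ∀ i, F i (i + 1) = F' i (i + 1))
    (hF : ∀ i j, i + 2 ≤ j → j ≤ n →
      ∃ p m, IsValley D i j p ∧ IsPeak D i j m ∧ F i j = cutSum a b F i j p m)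
    (hF' : ∀ i j, i + 2 ≤ j → j ≤ n →
      ∃ p m, IsValley D i j p ∧ IsPeak D i j m ∧ F' i j = cutSum a b F' i j p m)
    (i j : ℕ) (hij : i < j) (hj : j ≤ n) : F i j = F' i j := by
  induction hd : j - i using Nat.strong_induction_on generalizing i j with
  | _ d IH =>
    obtain rfl | hij2 := (Nat.succ_le_of_lt hij).eq_or_lt
    · exact h1 i
    obtain ⟨p, m, hp, hm, h⟩ := hF i j hij2 hj
    rw [h, cutIndep_of_exists ha hb hF' i j hij2 hj p m hp hm]
    have := hp.1
    have := hp.2.1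
    have := hm.1
    have := hm.2.1
    unfold cutSum
    split_ifs
    · refine Finset.sum_congr rfl fun x hx => ?_
      rw [Finset.mem_Ioc] at hx
      rw [IH (x - i) (by omega) i x (by omega) (by omega) rfl,
        IH (j - x) (by omega) x j (by omega) (by omega) rfl]
    · congr 1
      refine Finset.sum_congr rfl fun x hx => ?_
      rw [Finset.mem_Ioc] at hx
      rw [IH (x - i) (by omega) i x (by omega) (by omega) rfl,
        IH (j - x) (by omega) x j (by omega) (by omega) rfl]

end Abstract

/-! ### Standardization -/

lemma length_stdW (w : List ℕ) : (stdW w).length = w.length := by simp [stdW]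

lemma stdW_map {w : List ℕ} {g : ℕ → ℕ} (hg : StrictMonoOn g {x | x ∈ w}) :
    stdW (w.map g) = stdW w := by
  unfold stdW
  rw [List.map_map]
  refine List.map_congr_left fun x hx => ?_
  simp only [Function.comp, List.filter_map, List.length_map]
  congr 1
  refine List.filter_congr fun y hy => ?_
  simp [hg.le_iff_le hy hx]

lemma strictMonoOn_rank (w : List ℕ) :
    StrictMonoOn (fun x => (w.filter (· ≤ x)).length) {x | x ∈ w} := by
  suffices h : ∀ x y, y ∈ w → x < y → w.countP (· ≤ x) < w.countP (· ≤ y) by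
    intro x _ y hy hxy
    simpa only [← List.countP_eq_length_filter] using h x y hy hxy
  intro x y hy hxy
  induction w with
  | nil => simp at hy
  | cons z w ih =>
    have hle : w.countP (· ≤ x) ≤ w.countP (· ≤ y) :=
      List.countP_mono_left fun k _ hk => by
        simp only [decide_eq_true_eq] at hk ⊢
        omega
    simp only [List.countP_cons, decide_eq_true_eq]
    by_cases hyw : y ∈ w
    · have := ih hyw
      split_ifs <;> omega
    · have hyz : y = z := by simpa [hyw] using hy
      subst hyz
      split_ifs <;> omega

lemma stdW_take_stdW (w : List ℕ) (k : ℕ) : stdW ((stdW w).take k) = stdW (w.take k) := by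
  have h : (stdW w).take k = (w.take k).map fun x => (w.filter (· ≤ x)).length := by
    rw [stdW, List.map_take]
  rw [h, stdW_map ((strictMonoOn_rank w).mono fun x hx => List.mem_of_mem_take hx)]

lemma stdW_drop_stdW (w : List ℕ) (k : ℕ) : stdW ((stdW w).drop k) = stdW (w.drop k) := by
  have h : (stdW w).drop k = (w.drop k).map fun x => (w.filter (· ≤ x)).length := by
    rw [stdW, List.map_drop]
  rw [h, stdW_map ((strictMonoOn_rank w).mono fun x hx => List.mem_of_mem_drop hx)]

lemma nodup_stdW {w : List ℕ} (hw : w.Nodup) : (stdW w).Nodup :=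
  hw.map_on fun _ hx _ hy h => (strictMonoOn_rank w).injOn hx hy h

lemma cAux_eq_cAux (f f' : ℕ) (w : List ℕ) (hf : w.length ≤ f) (hf' : w.length ≤ f') :
    cAux f w = cAux f' w := by
  induction f generalizing f' w with
  | zero =>
    cases f' with
    | zero => rfl
    | succ f' => simp [cAux, show w.length ≤ 1 by omega]
  | succ f ih =>
    cases f' with
    | zero => simp [cAux, show w.length ≤ 1 by omega]
    | succ f' =>
      have key : ∀ k ∈ Finset.Ioo 0 w.length,
          cAux f (stdW (w.take k)) = cAux f' (stdW (w.take k)) ∧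
          cAux f (stdW (w.drop k)) = cAux f' (stdW (w.drop k)) := by
        intro k hk
        rw [Finset.mem_Ioo] at hk
        constructor <;> apply ih <;> simp only [length_stdW, List.length_take, List.length_drop] <;>
          omega
      simp only [cAux]
      split_ifs
      · rfl
      · congr 1 <;> refine Finset.sum_congr rfl fun k hk => ?_ <;>
          rw [(key k hk).1, (key k hk).2]

lemma cAux_eq_cpol {f : ℕ} {w : List ℕ} (hf : w.length ≤ f) : cAux f w = cpol w :=
  cAux_eq_cAux _ _ _ hf le_rfl

lemma cpol_stdW_eq {w : List ℕ} (hw : 2 ≤ w.length) :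
    cpol (stdW w) =
      (∑ k ∈ Finset.Ioo 0 w.length,
        if 1 ∈ (stdW w).take k ∧ w.length ∈ (stdW w).drop k then
          bW k * aW (w.length - k) * cpol (stdW (w.take k)) * cpol (stdW (w.drop k))
        else 0)
      -
      (∑ k ∈ Finset.Ioo 0 w.length,
        if w.length ∈ (stdW w).take k ∧ 1 ∈ (stdW w).drop k then
          aW k * bW (w.length - k) * cpol (stdW (w.take k)) * cpol (stdW (w.drop k))
        else 0) := by
  conv_lhs => rw [← cAux_eq_cpol (f := (w.length - 1) + 1) (by rw [length_stdW]; omega)]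
  have key : ∀ k ∈ Finset.Ioo 0 w.length,
      cAux (w.length - 1) (stdW (w.take k)) = cpol (stdW (w.take k)) ∧
      cAux (w.length - 1) (stdW (w.drop k)) = cpol (stdW (w.drop k)) := by
    intro k hk
    rw [Finset.mem_Ioo] at hk
    constructor <;> apply cAux_eq_cpol <;>
      simp only [length_stdW, List.length_take, List.length_drop] <;> omega
  rw [cAux, length_stdW, if_neg (by omega)]
  congr 1 <;> refine Finset.sum_congr rfl fun k hk => ?_ <;>
    rw [stdW_take_stdW, stdW_drop_stdW, (key k hk).1, (key k hk).2]

lemma stdW_getElem_eq_one {w : List ℕ} (hw : w.Nodup) {p : ℕ} (hp : p < w.length)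
    (hmin : ∀ x ∈ w, w[p] ≤ x) : (stdW w)[p]'(by rwa [length_stdW]) = 1 := by
  have : w.filter (· ≤ w[p]) = w.filter (· == w[p]) := by
    refine List.filter_congr fun x hx => ?_
    have := hmin x hx
    simp only [beq_eq_decide, decide_eq_decide]
    omega
  simp only [stdW, List.getElem_map, this]
  rw [← List.countP_eq_length_filter]
  exact List.count_eq_one_of_mem hw (List.getElem_mem hp)

lemma stdW_getElem_eq_length {w : List ℕ} {m : ℕ} (hm : m < w.length)
    (hmax : ∀ x ∈ w, x ≤ w[m]) : (stdW w)[m]'(by rwa [length_stdW]) = w.length := by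
  simp only [stdW, List.getElem_map]
  rw [List.filter_eq_self.2 fun x hx => by simpa using hmax x hx]

lemma getElem_mem_take_iff {w : List ℕ} (hw : w.Nodup) {p k : ℕ} (hp : p < w.length) :
    w[p] ∈ w.take k ↔ p < k := by
  rw [List.mem_take_iff_getElem]
  constructor
  · rintro ⟨i, hi, h⟩
    have := (hw.getElem_inj_iff).1 h
    omega
  · intro h
    exact ⟨p, by omega, rfl⟩

lemma getElem_mem_drop_iff {w : List ℕ} (hw : w.Nodup) {p k : ℕ} (hp : p < w.length) :
    w[p] ∈ w.drop k ↔ k ≤ p := by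
  rw [List.mem_drop_iff_getElem]
  constructor
  · rintro ⟨i, hi, h⟩
    have := (hw.getElem_inj_iff).1 h
    omega
  · intro h
    exact ⟨p - k, by omega, by simp [show k + (p - k) = p by omega]⟩

/-- The recursion for the polynomial of a word with minimum at position `p` and maximum at
position `m`. -/
lemma cpol_stdW_eq_sum_Ioc {w : List ℕ} (hn : w.Nodup) (hw : 2 ≤ w.length) {p m : ℕ}
    (hp : p < w.length) (hm : m < w.length)
    (hmin : ∀ x ∈ w, w[p] ≤ x) (hmax : ∀ x ∈ w, x ≤ w[m]) :
    cpol (stdW w) =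
      (∑ k ∈ Finset.Ioc p m,
        bW k * aW (w.length - k) * cpol (stdW (w.take k)) * cpol (stdW (w.drop k)))
      -
      (∑ k ∈ Finset.Ioc m p,
        aW k * bW (w.length - k) * cpol (stdW (w.take k)) * cpol (stdW (w.drop k))) := by
  have hp' : p < (stdW w).length := by rwa [length_stdW]
  have hm' : m < (stdW w).length := by rwa [length_stdW]
  have e1 := stdW_getElem_eq_one hn hp hmin
  have e2 := stdW_getElem_eq_length hm hmax
  have t1 : ∀ k, 1 ∈ (stdW w).take k ↔ p < k := fun k => by
    rw [← getElem_mem_take_iff (nodup_stdW hn) hp', e1]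
  have t2 : ∀ k, 1 ∈ (stdW w).drop k ↔ k ≤ p := fun k => by
    rw [← getElem_mem_drop_iff (nodup_stdW hn) hp', e1]
  have t3 : ∀ k, w.length ∈ (stdW w).take k ↔ m < k := fun k => by
    rw [← getElem_mem_take_iff (nodup_stdW hn) hm', e2]
  have t4 : ∀ k, w.length ∈ (stdW w).drop k ↔ k ≤ m := fun k => by
    rw [← getElem_mem_drop_iff (nodup_stdW hn) hm', e2]
  rw [cpol_stdW_eq hw]
  simp only [t1, t2, t3, t4]
  rw [← Finset.sum_filter, ← Finset.sum_filter]
  congr 1 <;> refine Finset.sum_congr ?_ fun _ _ => rfl <;> ext k <;>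
    simp only [Finset.mem_filter, Finset.mem_Ioo, Finset.mem_Ioc] <;> omega

/-! ### Factors of a word given by a function -/

/-- The word `f i, f (i + 1), …, f (j - 1)`. -/
def factor (f : ℕ → ℕ) (i j : ℕ) : List ℕ := (List.range' i (j - i)).map f

lemma length_factor (f : ℕ → ℕ) (i j : ℕ) : (factor f i j).length = j - i := by simp [factor]

lemma getElem_factor (f : ℕ → ℕ) (i j k : ℕ) (hk : k < (factor f i j).length) :
    (factor f i j)[k] = f (i + k) := by simp [factor]

lemma mem_factor {f : ℕ → ℕ} {i j x : ℕ} : x ∈ factor f i j ↔ ∃ k, i ≤ k ∧ k < j ∧ f k = x := by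
  simp only [factor, List.mem_map, List.mem_range'_1]
  exact exists_congr fun k => by
    constructor
    · rintro ⟨h1, h2⟩
      exact ⟨by omega, by omega, h2⟩
    · rintro ⟨h1, h2, h3⟩
      exact ⟨by omega, h3⟩

lemma take_factor {f : ℕ → ℕ} {i j k : ℕ} (h : i + k ≤ j) :
    (factor f i j).take k = factor f i (i + k) := by
  apply List.ext_getElem
  · simp [length_factor]
    omega
  · intro l _ _
    simp [getElem_factor]

lemma drop_factor (f : ℕ → ℕ) (i j k : ℕ) : (factor f i j).drop k = factor f (i + k) j := by
  apply List.ext_getElem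
  · simp [length_factor]
    omega
  · intro l _ _
    simp [getElem_factor, Nat.add_assoc]

lemma nodup_factor {f : ℕ → ℕ} {i j n : ℕ} (hf : Set.InjOn f (Set.Iio n)) (hj : j ≤ n) :
    (factor f i j).Nodup := by
  refine List.Nodup.map_on (fun x hx y hy h => hf ?_ ?_ h) List.nodup_range'
  · rw [List.mem_range'_1] at hx
    simp only [Set.mem_Iio]
    omega
  · rw [List.mem_range'_1] at hy
    simp only [Set.mem_Iio]
    omega

lemma exists_cutSum_cpol {f : ℕ → ℕ} {n : ℕ} (hf : Set.InjOn f (Set.Iio n)) {i j : ℕ}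
    (hij : i + 2 ≤ j) (hj : j ≤ n) :
    ∃ p m, IsValley (fun k => k + 1 < n ∧ f (k + 1) < f k) i j p ∧
      IsPeak (fun k => k + 1 < n ∧ f (k + 1) < f k) i j m ∧
      cpol (stdW (factor f i j)) =
        cutSum aW bW (fun x y => cpol (stdW (factor f x y))) i j p m := by
  have hne : (Finset.Ico i j).Nonempty := ⟨i, by simp; omega⟩
  obtain ⟨p, hp, hmin⟩ := Finset.exists_min_image _ f hne
  obtain ⟨m, hm, hmax⟩ := Finset.exists_max_image _ f hne
  simp only [Finset.mem_Ico] at hp hm hmin hmax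
  have hvalley : IsValley (fun k => k + 1 < n ∧ f (k + 1) < f k) i j p := by
    refine ⟨hp.1, hp.2, ?_, fun h1 h2 => ?_⟩
    · rintro k hk rfl
      refine ⟨by omega, lt_of_le_of_ne (hmin k (by omega)) fun h => ?_⟩
      have := hf (show k + 1 < n by omega) (show k < n by omega) h
      omega
    · have := hmin (p + 1) (by omega)
      omega
  have hpeak : IsPeak (fun k => k + 1 < n ∧ f (k + 1) < f k) i j m := by
    refine ⟨hm.1, hm.2, ?_, fun h1 h2 => h2 ⟨by omega, ?_⟩⟩
    · rintro k hk rfl ⟨-, h⟩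
      have := hmax k (by omega)
      omega
    · refine lt_of_le_of_ne (hmax (m + 1) (by omega)) fun h => ?_
      have := hf (show m + 1 < n by omega) (show m < n by omega) h
      omega
  refine ⟨p, m, hvalley, hpeak, ?_⟩
  have shift : ∀ (g : ℕ → MvPolynomial (Fin 2) ℤ) {s t : ℕ}, i ≤ s → i ≤ t →
      ∑ k ∈ Finset.Ioc (s - i) (t - i), g (i + k) = ∑ x ∈ Finset.Ioc s t, g x := by
    intro g s t hs ht
    refine Finset.sum_bij' (fun k _ => i + k) (fun x _ => x - i) ?_ ?_ ?_ ?_ fun _ _ => rfl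
    all_goals
      intro x hx
      rw [Finset.mem_Ioc] at hx
      try rw [Finset.mem_Ioc]
      omega
  have key := cpol_stdW_eq_sum_Ioc (nodup_factor (i := i) hf hj) (by rw [length_factor]; omega)
    (p := p - i) (m := m - i) (by rw [length_factor]; omega) (by rw [length_factor]; omega)
    (by
      intro x hx
      obtain ⟨k, h1, h2, rfl⟩ := mem_factor.1 hx
      rw [getElem_factor, show i + (p - i) = p by omega]
      exact hmin k ⟨h1, h2⟩)
    (by
      intro x hx
      obtain ⟨k, h1, h2, rfl⟩ := mem_factor.1 hx
      rw [getElem_factor, show i + (m - i) = m by omega]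
      exact hmax k ⟨h1, h2⟩)
  have e1 : ∀ {s t : ℕ} (u v : ℕ → MvPolynomial (Fin 2) ℤ), i ≤ s → i ≤ t → t < j →
      ∑ k ∈ Finset.Ioc (s - i) (t - i), u k * v ((factor f i j).length - k) *
        cpol (stdW ((factor f i j).take k)) * cpol (stdW ((factor f i j).drop k)) =
      ∑ x ∈ Finset.Ioc s t, u (x - i) * v (j - x) *
        cpol (stdW (factor f i x)) * cpol (stdW (factor f x j)) := by
    intro s t u v hs ht htj
    rw [← shift _ hs ht]
    refine Finset.sum_congr rfl fun k hk => ?_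
    rw [Finset.mem_Ioc] at hk
    rw [length_factor, take_factor (by omega), drop_factor, show i + k - i = k by omega,
      show j - (i + k) = j - i - k by omega]
  rw [key, e1 _ _ hp.1 hm.1 hm.2, e1 _ _ hm.1 hp.1 hp.2, cutSum]
  split_ifs with h
  · rw [Finset.Ioc_eq_empty_of_le h.le, Finset.sum_empty, sub_zero]
  · rw [Finset.Ioc_eq_empty_of_le (not_lt.1 h), Finset.sum_empty, zero_sub]

/-! ### Words of permutations -/

lemma length_permWord {n : ℕ} (σ : Equiv.Perm (Fin n)) : (permWord σ).length = n := by
  simp [permWord]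

lemma getD_permWord {n : ℕ} (σ : Equiv.Perm (Fin n)) {k : ℕ} (hk : k < n) :
    (permWord σ).getD k 0 = (σ ⟨k, hk⟩ : ℕ) + 1 := by
  rw [List.getD_eq_getElem _ _ (by rwa [length_permWord])]
  simp [permWord]

lemma factor_permWord {n : ℕ} (σ : Equiv.Perm (Fin n)) :
    factor (fun k => (permWord σ).getD k 0) 0 n = permWord σ := by
  apply List.ext_getElem
  · simp [length_factor, length_permWord]
  · intro k hk hk'
    rw [getElem_factor, Nat.zero_add, List.getD_eq_getElem]

lemma injOn_permWord {n : ℕ} (σ : Equiv.Perm (Fin n)) :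
    Set.InjOn (fun k => (permWord σ).getD k 0) (Set.Iio n) := by
  intro x hx y hy h
  simp only [Set.mem_Iio] at hx hy
  simp only [getD_permWord σ hx, getD_permWord σ hy, Nat.add_right_cancel_iff] at h
  exact congrArg Fin.val (σ.injective (Fin.ext h))

lemma stdW_permWord {n : ℕ} (σ : Equiv.Perm (Fin n)) : stdW (permWord σ) = permWord σ := by
  have hperm : (permWord σ).Perm (List.range' 1 n) := by
    rw [List.perm_ext_iff_of_nodup _ List.nodup_range']
    · intro x
      rw [permWord, List.mem_ofFn, List.mem_range'_1]
      constructor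
      · rintro ⟨i, rfl⟩
        have := (σ i).2
        omega
      · rintro ⟨h1, h2⟩
        exact ⟨σ.symm ⟨x - 1, by omega⟩, by simp; omega⟩
    · rw [← factor_permWord]
      exact nodup_factor (injOn_permWord σ) le_rfl
  conv_rhs => rw [← List.map_id (permWord σ)]
  refine List.map_congr_left fun x hx => ?_
  have hx' := List.mem_range'_1.1 (hperm.mem_iff.1 hx)
  rw [(hperm.filter _).length_eq, id,
    ← List.toFinset_card_of_nodup (List.Nodup.filter _ List.nodup_range')]
  have : (List.filter (fun y => decide (y ≤ x)) (List.range' 1 n)).toFinset = Finset.Icc 1 x := by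
    ext y
    simp only [List.mem_toFinset, List.mem_filter, List.mem_range'_1, decide_eq_true_eq,
      Finset.mem_Icc]
    omega
  rw [this, Nat.card_Icc, Nat.add_sub_cancel]

lemma succ_mem_desSet_permWord {n : ℕ} (σ : Equiv.Perm (Fin n)) (k : ℕ) :
    k + 1 ∈ desSet (permWord σ) ↔
      k + 1 < n ∧ (permWord σ).getD (k + 1) 0 < (permWord σ).getD k 0 := by
  simp only [desSet, Finset.mem_filter, Finset.mem_Icc, length_permWord, Nat.add_sub_cancel]
  exact and_congr_left fun _ => by omega

theorem stmt5 : ∀ n : ℕ, 1 ≤ n → ∀ σ τ : Equiv.Perm (Fin n),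
    desSet (permWord σ) = desSet (permWord τ) → cpol (permWord σ) = cpol (permWord τ) := by
  intro n hn σ τ h
  have hrec : ∀ ρ : Equiv.Perm (Fin n), ∀ i j, i + 2 ≤ j → j ≤ n →
      ∃ p m, IsValley (fun k => k + 1 ∈ desSet (permWord ρ)) i j p ∧
        IsPeak (fun k => k + 1 ∈ desSet (permWord ρ)) i j m ∧
        cpol (stdW (factor (fun k => (permWord ρ).getD k 0) i j)) =
          cutSum aW bW
            (fun x y => cpol (stdW (factor (fun k => (permWord ρ).getD k 0) x y))) i j p m := by
    intro ρ i j hij hj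
    simp only [succ_mem_desSet_permWord]
    exact exists_cutSum_cpol (injOn_permWord ρ) hij hj
  have hσ := hrec σ
  rw [h] at hσ
  have := eq_of_exists_cutSum (fun k hk => by simp [aW, hk]) (fun k hk => by simp [bW, hk])
    (fun i => by simp [cpol, cAux, length_stdW, length_factor]) hσ (hrec τ) 0 n hn le_rfl
  simpa only [factor_permWord, stdW_permWord] using this
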